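/- arXiv:1311.3240 — 3 statements merged into one kernel-verified Lean document; each statement's English description precedes it below -/
import Mathlib

section
/- For every integer n ≥ 2, the proportion of connected forests among all forests on vertex set {1,…,n} satisfies |𝒯ₙ| / |ℱₙ| < e^{-1/3}. -/
/-- The number of trees on vertex set `{1,…,n}`. -/
noncomputable def treeCount (n : ℕ) : ℕ :=
  {T : SimpleGraph (Fin n) | T.IsTree}.ncard

/-- The number of forests on vertex set `{1,…,n}`. -/
noncomputable def forestCount (n : ℕ) : ℕ :=
  {F : SimpleGraph (Fin n) | F.IsAcyclic}.ncard

namespace SimpleGraph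

variable {V : Type*} {s : Set V}

/-- A cycle cannot visit a vertex with at most one neighbour. -/
lemma isAcyclic_of_induce {G : SimpleGraph V} (hs : ∀ v ∉ s, (G.neighborSet v).Subsingleton)
    (h : (G.induce s).IsAcyclic) : G.IsAcyclic := by
  intro v c hc
  have hsupp : ∀ x ∈ c.support, x ∈ s := by
    intro x hx
    by_contra hxs
    have h2 := hc.ncard_neighborSet_toSubgraph_eq_two hx
    have h1 : (c.toSubgraph.neighborSet x).ncard ≤ 1 :=
      haveI := ((hs x hxs).anti (c.toSubgraph.neighborSet_subset x)).finite.to_subtype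
      Set.ncard_le_one_iff_subsingleton.2 ((hs x hxs).anti (c.toSubgraph.neighborSet_subset x))
    omega
  refine h (c.induce s hsupp) (Walk.IsCycle.of_map (f := (Embedding.induce s).toHom) ?_)
  rwa [Walk.map_induce]

/-- The graph obtained from `H` by attaching each vertex `v` outside `s` as a pendant vertex
at `f v`. -/
def attachLeaves (H : SimpleGraph s) (f : ↥sᶜ → s) : SimpleGraph V :=
  H.spanningCoe ⊔ fromRel fun u v => ∃ h : u ∈ sᶜ, (f ⟨u, h⟩ : V) = v

lemma attachLeaves_adj_of_notMem (H : SimpleGraph s) (f : ↥sᶜ → s) (u : ↥sᶜ) (v : V) :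
    (attachLeaves H f).Adj u v ↔ v = f u := by
  have hu : (u : V) ∉ s := u.2
  have hf : ∀ w : ↥sᶜ, (f w : V) ∈ s := fun w => (f w).2
  simp only [attachLeaves, sup_adj, fromRel_adj, map_adj, Function.Embedding.subtype_apply]
  constructor
  · rintro (⟨a, b, -, ha, -⟩ | ⟨-, ⟨_, h⟩ | ⟨h', h⟩⟩)
    · exact absurd (ha ▸ a.2) hu
    · exact h.symm
    · exact absurd (h ▸ hf _) hu
  · rintro rfl
    exact .inr ⟨fun h => hu (h ▸ hf _), .inl ⟨hu, rfl⟩⟩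

lemma induce_attachLeaves (H : SimpleGraph s) (f : ↥sᶜ → s) :
    (attachLeaves H f).induce s = H := by
  ext u v
  have hu : (u : V) ∈ s := u.2
  have hv : (v : V) ∈ s := v.2
  simp [attachLeaves, hu, hv]

lemma attachLeaves_injective :
    Function.Injective fun p : SimpleGraph s × (↥sᶜ → s) => attachLeaves p.1 p.2 := by
  rintro ⟨H, f⟩ ⟨H', f'⟩ h
  dsimp only at h
  have hH : H = H' := by
    rw [← induce_attachLeaves H f, h, induce_attachLeaves]
  have hf : f = f' := by
    funext u
    have := (attachLeaves_adj_of_notMem H f u (f u)).2 rfl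
    rw [h, attachLeaves_adj_of_notMem] at this
    exact Subtype.ext this
  rw [hH, hf]

lemma eq_attachLeaves {G : SimpleGraph V} {f : ↥sᶜ → s}
    (hf : ∀ (u : ↥sᶜ) v, G.Adj u v ↔ v = f u) : G = attachLeaves (G.induce s) f := by
  ext u v
  by_cases hu : u ∈ s
  · by_cases hv : v ∈ s
    · have := induce_attachLeaves (G.induce s) f
      exact (congrArg (fun K : SimpleGraph s => K.Adj ⟨u, hu⟩ ⟨v, hv⟩) this).symm.to_iff
    · rw [G.adj_comm, adj_comm _ u, hf ⟨v, hv⟩, ← attachLeaves_adj_of_notMem (G.induce s) f ⟨v, hv⟩]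
  · rw [hf ⟨u, hu⟩, ← attachLeaves_adj_of_notMem (G.induce s) f ⟨u, hu⟩]

lemma isTree_attachLeaves_iff (H : SimpleGraph s) (f : ↥sᶜ → s) :
    (attachLeaves H f).IsTree ↔ H.IsTree := by
  classical
  set G := attachLeaves H f with hG
  have hind : G.induce s = H := induce_attachLeaves H f
  have hadj : ∀ (u : ↥sᶜ) v, G.Adj u v ↔ v = f u := attachLeaves_adj_of_notMem H f
  let r : V → s := fun v => if h : v ∈ s then ⟨v, h⟩ else f ⟨v, h⟩
  have hrs : ∀ v : s, r v = v := fun v => by simp [r]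
  have hrl : ∀ v : ↥sᶜ, r v = f v := fun v => dif_neg v.2
  have hsub : ∀ {u v : s}, H.Reachable u v → G.Reachable u v := fun {u v} h => by
    rw [← hind] at h
    exact h.map (Embedding.induce s).toHom
  have hself : ∀ v, G.Reachable v (r v) := fun v => by
    by_cases hv : v ∈ s
    · rw [hrs ⟨v, hv⟩]
    · rw [hrl ⟨v, hv⟩]
      exact ((hadj ⟨v, hv⟩ _).2 rfl).reachable
  have hretract : ∀ {u v}, G.Reachable u v → H.Reachable (r u) (r v) := by
    rintro u v ⟨p⟩
    induction p with
    | nil => rfl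
    | @cons a b c hab _ ih =>
      refine Reachable.trans ?_ ih
      by_cases ha : a ∈ s
      · by_cases hb : b ∈ s
        · rw [hrs ⟨a, ha⟩, hrs ⟨b, hb⟩]
          refine Adj.reachable ?_
          rw [← hind]
          exact hab
        · rw [(hadj ⟨b, hb⟩ a).1 hab.symm, hrs, hrl ⟨b, hb⟩]
      · rw [(hadj ⟨a, ha⟩ b).1 hab, hrs, hrl ⟨a, ha⟩]
  constructor
  · intro h
    have hne : Nonempty s := h.connected.nonempty.map r
    refine ⟨⟨fun u v => ?_⟩, hind ▸ h.isAcyclic.induce s⟩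
    have := hretract (h.connected.preconnected u v)
    rwa [hrs, hrs] at this
  · intro h
    have hne : Nonempty V := h.connected.nonempty.map Subtype.val
    refine ⟨⟨fun u v => ?_⟩, isAcyclic_of_induce (s := s) ?_ (hind ▸ h.isAcyclic)⟩
    · exact (hself u).trans ((hsub (h.connected.preconnected _ _)).trans (hself v).symm)
    · intro v hv a ha b hb
      rw [(hadj ⟨v, hv⟩ a).1 ha, (hadj ⟨v, hv⟩ b).1 hb]

/-- The vertices with exactly one neighbour. -/
def leaves (G : SimpleGraph V) : Set V := {v | ∃! w, G.Adj v w}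

lemma Connected.not_adj_of_mem_leaves [Finite V] {G : SimpleGraph V} (hG : G.Connected)
    (hV : 3 ≤ Nat.card V) {u v : V} (hu : u ∈ G.leaves) (hv : v ∈ G.leaves) : ¬ G.Adj u v := by
  intro huv
  have hclosed : ∀ {a b}, G.Reachable a b → a ∈ ({u, v} : Set V) → b ∈ ({u, v} : Set V) := by
    rintro a b ⟨p⟩
    induction p with
    | nil => exact id
    | @cons a b c hab _ ih =>
      rintro (rfl | rfl)
      · exact ih (.inr (hu.unique hab huv))
      · exact ih (.inl (hv.unique hab huv.symm))
  have huniv : (Set.univ : Set V) ⊆ {u, v} := fun x _ =>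
    hclosed (hG.preconnected u x) (.inl rfl)
  have := (Set.ncard_le_ncard huniv).trans (Set.ncard_insert_le u {v})
  rw [Set.ncard_univ, Set.ncard_singleton] at this
  omega

lemma trees_with_leaves_eq_image [Finite V] (hV : 3 ≤ Nat.card V) :
    {G : SimpleGraph V | G.IsTree ∧ sᶜ ⊆ G.leaves} =
      (fun p : SimpleGraph s × (↥sᶜ → s) => attachLeaves p.1 p.2) ''
        ({H | H.IsTree} ×ˢ Set.univ) := by
  ext G
  constructor
  · rintro ⟨hG, hs⟩
    have hex : ∀ u : ↥sᶜ, ∃ w : s, G.Adj u w := fun u => by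
      obtain ⟨w, hw, -⟩ := hs u.2
      refine ⟨⟨w, ?_⟩, hw⟩
      by_contra hws
      exact hG.connected.not_adj_of_mem_leaves hV (hs u.2) (hs hws) hw
    choose f hf using hex
    have hGf : G = attachLeaves (G.induce s) f := eq_attachLeaves fun u v =>
      ⟨fun h => (hs u.2).unique h (hf u), fun h => h ▸ hf u⟩
    refine ⟨(G.induce s, f), ⟨?_, trivial⟩, hGf.symm⟩
    exact (isTree_attachLeaves_iff _ f).1 (hGf ▸ hG)
  · rintro ⟨⟨H, f⟩, ⟨hH, -⟩, rfl⟩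
    refine ⟨(isTree_attachLeaves_iff H f).2 hH, fun v hv => ⟨f ⟨v, hv⟩, ?_, fun w hw => ?_⟩⟩
    · exact (attachLeaves_adj_of_notMem H f ⟨v, hv⟩ _).2 rfl
    · exact (attachLeaves_adj_of_notMem H f ⟨v, hv⟩ _).1 hw

lemma ncard_isTree (V : Type*) [Finite V] :
    {T : SimpleGraph V | T.IsTree}.ncard = treeCount (Nat.card V) := by
  let e := Finite.equivFin V
  refine Set.ncard_congr' ((e.simpleGraph).subtypeEquiv fun G => ?_)
  exact (Iso.comap e.symm G).isTree_iff.symm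

lemma ncard_trees_with_leaves [Finite V] (hV : 3 ≤ Nat.card V) (s : Set V) :
    {G : SimpleGraph V | G.IsTree ∧ sᶜ ⊆ G.leaves}.ncard =
      treeCount s.ncard * s.ncard ^ sᶜ.ncard := by
  rw [trees_with_leaves_eq_image hV, Set.ncard_image_of_injective _ attachLeaves_injective,
    Set.ncard_prod, ncard_isTree, Set.ncard_univ, Nat.card_fun, Nat.card_coe_set_eq,
    Nat.card_coe_set_eq]


lemma IsTree.leaves_nonempty [Finite V] [Nontrivial V] {G : SimpleGraph V} (hG : G.IsTree) :
    G.leaves.Nonempty := by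
  classical
  have := Fintype.ofFinite V
  obtain ⟨v, hv⟩ := hG.exists_vert_degree_one_of_nontrivial
  exact ⟨v, degree_eq_one_iff_existsUnique_adj.1 hv⟩

end SimpleGraph

open Finset SimpleGraph

lemma treeCount_one : treeCount 1 = 1 := by
  have : {T : SimpleGraph (Fin 1) | T.IsTree} = {⊥} := by
    ext T
    simp [IsTree.of_subsingleton, Subsingleton.elim T ⊥]
  rw [treeCount, this, Set.ncard_singleton]

lemma treeCount_two : treeCount 2 = 1 := by
  have : {T : SimpleGraph (Fin 2) | T.IsTree} = {⊤} := by
    ext T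
    constructor
    · intro hT
      have h01 : T.Adj 0 1 := by
        obtain ⟨w, hw⟩ := hT.connected.preconnected.exists_adj_of_nontrivial (0 : Fin 2)
        rwa [← Fin.eq_one_of_ne_zero w hw.ne']
      refine eq_top_iff.2 fun u v huv => ?_
      fin_cases u <;> fin_cases v <;> simp_all [T.adj_comm]
    · rintro rfl
      exact ⟨connected_top, IsAcyclic.of_card_le_two (by simp)⟩
  rw [treeCount, this, Set.ncard_singleton]

/-- Inclusion–exclusion over the sets of leaves, indexed by the complement of such a set. -/
lemma sum_treeCount_mul_pow_eq_zero {n : ℕ} (hn : 3 ≤ n) :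
    ∑ k ∈ range (n + 1), ((-1 : ℤ) ^ (n - k) * n.choose k) * (treeCount k * k ^ (n - k)) = 0 := by
  classical
  have : Nontrivial (Fin n) := Fin.nontrivial_iff_two_le.2 (by omega)
  have hcount : ∀ S : Finset (Fin n),
      (treeCount #S * #S ^ (n - #S) : ℤ) =
        ∑ T : SimpleGraph (Fin n) with T.IsTree, if (↑Sᶜ : Set (Fin n)) ⊆ T.leaves then 1 else 0 := by
    intro S
    have := ncard_trees_with_leaves (V := Fin n) (by simpa using hn) (S : Set (Fin n))
    rw [← coe_compl, Set.ncard_coe_finset, Set.ncard_coe_finset, card_compl,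
      Fintype.card_fin] at this
    rw [← Nat.cast_pow, ← Nat.cast_mul, ← this, sum_boole, filter_filter,
      ← Set.ncard_coe_finset {T : SimpleGraph (Fin n) | _}, coe_filter]
    simp only [mem_univ, true_and]
  calc
    _ = ∑ S : Finset (Fin n), (-1 : ℤ) ^ (n - #S) * (treeCount #S * #S ^ (n - #S)) := by
      have := sum_powerset_apply_card
        (fun k => (-1 : ℤ) ^ (n - k) * (treeCount k * k ^ (n - k))) (x := (univ : Finset (Fin n)))
      rw [powerset_univ, card_univ, Fintype.card_fin] at this
      rw [this]
      refine sum_congr rfl fun k _ => ?_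
      rw [nsmul_eq_mul]
      ring
    _ = ∑ T : SimpleGraph (Fin n) with T.IsTree, ∑ S : Finset (Fin n),
          if (↑Sᶜ : Set (Fin n)) ⊆ T.leaves then (-1 : ℤ) ^ #Sᶜ else 0 := by
      rw [sum_comm]
      refine sum_congr rfl fun S _ => ?_
      rw [hcount, mul_sum]
      refine sum_congr rfl fun T _ => ?_
      rw [card_compl, Fintype.card_fin]
      split_ifs <;> simp
    _ = 0 := by
      refine sum_eq_zero fun T hT => ?_
      have hne : T.leaves.toFinset.Nonempty :=
        Set.toFinset_nonempty.2 (mem_filter.1 hT).2.leaves_nonempty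
      refine Eq.trans ?_ (sum_powerset_neg_one_pow_card_of_nonempty hne)
      refine ((compl_involutive (α := Finset (Fin n))).bijective.sum_comp fun S =>
        if (S : Set (Fin n)) ⊆ T.leaves then (-1 : ℤ) ^ #S else 0).trans ?_
      rw [← sum_filter]
      refine sum_congr ?_ fun _ _ => rfl
      ext S
      simp [← coe_subset]

/-- Cayley's formula. -/
theorem treeCount_eq_pow (n : ℕ) (hn : 1 ≤ n) : treeCount n = n ^ (n - 2) := by
  induction n using Nat.strong_induction_on with
  | _ n ih =>
  obtain rfl | rfl | h3 : n = 1 ∨ n = 2 ∨ 3 ≤ n := by omega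
  · simpa using treeCount_one
  · simpa using treeCount_two
  have hrec := sum_treeCount_mul_pow_eq_zero h3
  have hdiff : ∑ k ∈ range (n + 1), ((-1 : ℤ) ^ (n - k) * n.choose k) * (k : ℤ) ^ (n - 2) = 0 := by
    have := congrFun (fwdDiff_iter_pow_eq_zero_of_lt (R := ℤ) (show n - 2 < n by omega)) 0
    rw [fwdDiff_iter_eq_sum_shift] at this
    simpa using this
  rw [sum_range_succ] at hrec hdiff
  have hlow : ∀ k ∈ range n,
      ((-1 : ℤ) ^ (n - k) * n.choose k) * (treeCount k * k ^ (n - k)) =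
        ((-1 : ℤ) ^ (n - k) * n.choose k) * (k : ℤ) ^ (n - 2) := by
    intro k hk
    have hkn := mem_range.1 hk
    congr 1
    obtain rfl | rfl | hk2 : k = 0 ∨ k = 1 ∨ 2 ≤ k := by omega
    · simp [show n ≠ 0 by omega, show n - 2 ≠ 0 by omega]
    · simp [treeCount_one]
    · rw [ih k hkn (by omega)]
      push_cast
      rw [← pow_add]
      congr 1
      omega
  rw [sum_congr rfl hlow] at hrec
  have : (treeCount n : ℤ) = (n : ℤ) ^ (n - 2) := by
    simp only [Nat.sub_self, pow_zero, Nat.choose_self, Nat.cast_one, mul_one, one_mul] at hrec hdiff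
    linarith
  exact_mod_cast this

/-- Forests with exactly one nontrivial component, sorted by the size of that component. -/
lemma sum_choose_mul_treeCount_le_forestCount (n : ℕ) :
    ∑ k ∈ range (n + 1) with 2 ≤ k, n.choose k * treeCount k ≤ forestCount n := by
  classical
  let X := Σ S : {S : Finset (Fin n) // 2 ≤ #S},
    {H : SimpleGraph (S.1 : Set (Fin n)) // H.IsTree}
  have hsupport : ∀ x : X, x.2.1.spanningCoe.support = (x.1.1 : Set (Fin n)) := by
    rintro ⟨⟨S, hS⟩, H, hH⟩
    have hnt : Nontrivial (S : Set (Fin n)) := 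
      (one_lt_card_iff_nontrivial.1 hS).coe_sort
    ext v
    constructor
    · rintro ⟨w, hw⟩
      obtain ⟨a, b, -, rfl, -⟩ := (map_adj _ _ _ _).1 hw
      exact a.2
    · intro hv
      obtain ⟨w, hw⟩ := hH.connected.preconnected.exists_adj_of_nontrivial ⟨v, hv⟩
      exact ⟨w, (map_adj _ _ _ _).2 ⟨_, _, hw, rfl, rfl⟩⟩
  have hacyclic : ∀ x : X, x.2.1.spanningCoe.IsAcyclic := by
    intro x
    refine isAcyclic_of_induce (s := (x.1.1 : Set (Fin n))) (fun v hv a ha => ?_) ?_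
    · rw [← hsupport x] at hv
      exact absurd ⟨a, ha⟩ hv
    · rw [induce_spanningCoe]
      exact x.2.2.isAcyclic
  have hinj : Function.Injective
      fun x : X => (⟨x.2.1.spanningCoe, hacyclic x⟩ : {F : SimpleGraph (Fin n) | F.IsAcyclic}) := by
    intro x y hxy
    have hxy' : x.2.1.spanningCoe = y.2.1.spanningCoe := congrArg Subtype.val hxy
    have hS : (x.1.1 : Set (Fin n)) = y.1.1 := by rw [← hsupport x, ← hsupport y, hxy']
    obtain ⟨⟨S, hS⟩, H, hH⟩ := x
    obtain ⟨⟨S', hS'⟩, H', hH'⟩ := y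
    obtain rfl : S = S' := coe_injective hS
    obtain rfl : H = H' := by
      rw [← induce_spanningCoe (G := H), ← induce_spanningCoe (G := H')]
      exact congrArg (SimpleGraph.induce _) hxy'
    rfl
  have hle := Nat.card_le_card_of_injective _ hinj
  rw [Nat.card_coe_set_eq, Nat.card_sigma] at hle
  refine le_trans (le_of_eq ?_) hle
  have hcard : ∀ S : Finset (Fin n),
      Nat.card {H : SimpleGraph (S : Set (Fin n)) // H.IsTree} = treeCount #S := by
    intro S
    have := ncard_isTree (S : Set (Fin n))
    rwa [Nat.card_coe_set_eq, Set.ncard_coe_finset] at this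
  simp only [hcard]
  have := sum_powerset_apply_card
    (fun k => if 2 ≤ k then treeCount k else 0) (x := (univ : Finset (Fin n)))
  rw [powerset_univ, card_univ, Fintype.card_fin, ← sum_filter] at this
  rw [← sum_subtype_eq_sum_filter, Finset.subtype_univ] at this
  rw [this, sum_filter]
  refine sum_congr rfl fun k _ => ?_
  simp

lemma exp_neg_mul_add_pow_le {a : ℝ} (ha : 0 ≤ a) {k : ℕ} (hk : 0 < k) :
    Real.exp (-a) * ((k : ℝ) + a) ^ k ≤ (k : ℝ) ^ k := by
  have hk' : (0 : ℝ) < k := by exact_mod_cast hk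
  have h : ((k : ℝ) + a) / k ≤ Real.exp (a / k) := by
    rw [add_div, div_self hk'.ne', add_comm]
    exact Real.add_one_le_exp _
  have hp := pow_le_pow_left₀ (by positivity) h k
  rwa [← Real.exp_nat_mul, div_pow, div_le_iff₀ (by positivity), mul_div_cancel₀ _ hk'.ne',
    ← inv_mul_le_iff₀ (Real.exp_pos _), ← Real.exp_neg] at hp

/-- The contribution of forests with at most two isolated vertices and one other component. -/
lemma exp_bound_le_forestCount {n : ℕ} (hn : 4 ≤ n) :
    (n : ℝ) ^ (n - 2) * (1 + Real.exp (-1) + Real.exp (-2) / 2) ≤ forestCount n := by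
  have hsum : n ^ (n - 2) + n * (n - 1) ^ (n - 3) + n.choose 2 * (n - 2) ^ (n - 4) ≤
      forestCount n := by
    refine le_trans ?_ (sum_choose_mul_treeCount_le_forestCount n)
    refine le_trans (le_of_eq ?_) (sum_le_sum_of_subset (s := {n, n - 1, n - 2}) ?_)
    · rw [sum_insert (by simp; omega), sum_insert (by simp; omega), sum_singleton,
        treeCount_eq_pow _ (by omega), treeCount_eq_pow _ (by omega),
        treeCount_eq_pow _ (by omega), Nat.choose_self, Nat.choose_symm (by omega : 1 ≤ n),
        Nat.choose_symm (by omega : 2 ≤ n), Nat.choose_one_right, Nat.sub_sub, Nat.sub_sub]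
      ring
    · intro k hk
      simp only [mem_insert, mem_singleton] at hk
      simp only [mem_filter, mem_range]
      omega
  obtain ⟨m, rfl⟩ : ∃ m, n = m + 4 := ⟨n - 4, by omega⟩
  have hsum' : ((m : ℝ) + 4) ^ (m + 2) + (m + 4) * (m + 3) ^ (m + 1) +
      (m + 4) * (m + 3) / 2 * (m + 2) ^ m ≤ forestCount (m + 4) := by
    have := (Nat.cast_le (α := ℝ)).2 hsum
    push_cast [Nat.cast_choose_two, show m + 4 - 2 = m + 2 by omega,
      show m + 4 - 1 = m + 3 by omega, show m + 4 - 3 = m + 1 by omega,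
      show m + 4 - 4 = m by omega] at this
    rwa [show (m : ℝ) + 4 - 1 = m + 3 by ring] at this
  have h1 : Real.exp (-1) * ((m : ℝ) + 4) ^ (m + 3) ≤ (m + 3) ^ (m + 3) := by
    have := exp_neg_mul_add_pow_le zero_le_one (show 0 < m + 3 by omega)
    push_cast at this
    rwa [show (m : ℝ) + 3 + 1 = m + 4 by ring] at this
  have h2 : Real.exp (-2) * ((m : ℝ) + 4) ^ (m + 2) ≤ (m + 2) ^ (m + 2) := by
    have := exp_neg_mul_add_pow_le zero_le_two (show 0 < m + 2 by omega)
    push_cast at this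
    rwa [show (m : ℝ) + 2 + 2 = m + 4 by ring] at this
  have h1' : Real.exp (-1) * ((m : ℝ) + 4) ^ (m + 2) ≤ (m + 4) * (m + 3) ^ (m + 1) := by
    refine le_of_mul_le_mul_right ?_ (show (0 : ℝ) < m + 4 by positivity)
    calc _ = Real.exp (-1) * ((m : ℝ) + 4) ^ (m + 3) := by ring
      _ ≤ (m + 3) ^ (m + 3) := h1
      _ = (m + 3) ^ (m + 1) * ((m + 3) * (m + 3)) := by ring
      _ ≤ (m + 3) ^ (m + 1) * ((m + 4) * (m + 4)) := by gcongr <;> norm_num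
      _ = _ := by ring
  have h2' : Real.exp (-2) * ((m : ℝ) + 4) ^ (m + 2) ≤ (m + 4) * (m + 3) * (m + 2) ^ m := by
    calc _ ≤ ((m : ℝ) + 2) ^ (m + 2) := h2
      _ = (m + 2) * (m + 2) * (m + 2) ^ m := by ring
      _ ≤ _ := by gcongr <;> norm_num
  push_cast [show m + 4 - 2 = m + 2 by omega]
  linarith

lemma exp_third_lt : Real.exp (1 / 3) < 1.4 := by
  refine lt_of_pow_lt_pow_left₀ 3 (by norm_num) ?_
  rw [← Real.exp_nat_mul]
  norm_num
  linarith [Real.exp_one_lt_d9]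

lemma exp_third_mul_treeCount_lt_forestCount {n : ℕ} (hn : 2 ≤ n) :
    Real.exp (1 / 3) * treeCount n < forestCount n := by
  have hexp := exp_third_lt
  obtain rfl | rfl | h4 : n = 2 ∨ n = 3 ∨ 4 ≤ n := by omega
  · have hlt : treeCount 2 < forestCount 2 := by
      refine Set.ncard_lt_ncard (Set.ssubset_iff_of_subset (fun T hT => hT.isAcyclic) |>.2
        ⟨⊥, isAcyclic_bot, fun h => ?_⟩)
      obtain ⟨w, hw⟩ := h.connected.preconnected.exists_adj_of_nontrivial (0 : Fin 2)
      exact hw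
    rw [treeCount_two] at hlt ⊢
    have : (2 : ℝ) ≤ forestCount 2 := by exact_mod_cast hlt
    push_cast
    linarith
  · have h := sum_choose_mul_treeCount_le_forestCount 3
    have h3 : treeCount 3 = 3 := by simpa using treeCount_eq_pow 3 (by norm_num)
    have hset : {k ∈ range (3 + 1) | 2 ≤ k} = {2, 3} := by decide
    rw [hset, sum_pair (by norm_num), treeCount_two, h3] at h
    have : (6 : ℝ) ≤ forestCount 3 := by exact_mod_cast h
    rw [h3]
    push_cast
    linarith
  · refine lt_of_lt_of_le ?_ (exp_bound_le_forestCount h4)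
    rw [treeCount_eq_pow n (by omega), mul_comm]
    push_cast
    have hn0 : (0 : ℝ) < n := by positivity
    gcongr
    have h1 := Real.exp_neg_one_gt_d9
    have h2 : Real.exp (-2) = Real.exp (-1) * Real.exp (-1) := by
      rw [← Real.exp_add]
      norm_num
    nlinarith

theorem forest_connected_prob_lt_exp_third (n : ℕ) (hn : 2 ≤ n) :
    (treeCount n : ℝ) / (forestCount n : ℝ) < Real.exp (-(1 / 3)) := by
  have h := exp_third_mul_treeCount_lt_forestCount hn
  have hpos : (0 : ℝ) < forestCount n := lt_of_le_of_lt (by positivity) h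
  rwa [div_lt_iff₀ hpos, Real.exp_neg, lt_inv_mul_iff₀ (Real.exp_pos _)]
end

section
/- For every integer n ≥ 2, the proportion of connected forests among all forests on vertex set {1,…,n} satisfies |𝒯ₙ| / |ℱₙ| < e^{-0.48}. -/
namespace SimpleGraph

open Finset

open scoped Classical

noncomputable section

variable {V : Type*} {G : SimpleGraph V} {u v x y : V}

/-- The indicator of the event that `x` and `y` lie in different components of `G`. -/
def sep (G : SimpleGraph V) (x y : V) : ℝ := if G.Reachable x y then 0 else 1

/-- The indicator of the event that `u` and `v` are adjacent in `G`. -/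
def adjInd (G : SimpleGraph V) (u v : V) : ℝ := if G.Adj u v then 1 else 0

lemma sep_comm (G : SimpleGraph V) (x y : V) : G.sep x y = G.sep y x := by
  simp only [sep, reachable_comm]

/-- Among three vertices two of which are separated, the third is connected to at most one of
them. -/
lemma sep_mul_sep_mul_sep (G : SimpleGraph V) (x y z : V) :
    G.sep x y * (G.sep x z * G.sep y z) = G.sep x y * (G.sep x z + G.sep y z - 1) := by
  by_cases hx : G.Reachable x z
  · by_cases hy : G.Reachable y z
    · simp [sep, hx.trans hy.symm]
    · simp [sep, hx, hy]
  · simp [sep, hx]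

lemma sep_mul_one_sub_sep (G : SimpleGraph V) (w z u : V) :
    G.sep w u * (1 - G.sep z u) = G.sep w z * (1 - G.sep u z) := by
  rw [G.sep_comm u z]
  by_cases hz : G.Reachable z u
  · have : G.Reachable w u ↔ G.Reachable w z := ⟨fun h ↦ h.trans hz.symm, fun h ↦ h.trans hz⟩
    simp [sep, hz, this]
  · simp [sep, hz]

lemma reachable_sup_edge_iff :
    (G ⊔ edge u v).Reachable x y ↔ G.Reachable x y ∨ (G.Reachable x u ∧ G.Reachable v y) ∨
      (G.Reachable x v ∧ G.Reachable u y) := by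
  have mono {a b : V} (h : G.Reachable a b) : (G ⊔ edge u v).Reachable a b := h.mono le_sup_left
  have huv : (G ⊔ edge u v).Reachable u v := by
    rcases eq_or_ne u v with rfl | hne
    · rfl
    · exact Adj.reachable (by simp [edge_adj, hne])
  constructor
  · rintro ⟨p⟩
    induction p with
    | nil => exact .inl .rfl
    | @cons a b c h p ih =>
      rw [sup_adj, edge_adj] at h
      rcases h with h | ⟨⟨rfl, rfl⟩ | ⟨rfl, rfl⟩, -⟩
      · have := h.reachable
        exact ih.imp this.trans (.imp (.imp_left this.trans) (.imp_left this.trans))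
      · rcases ih with h | h | h
        · exact .inr (.inl ⟨.rfl, h⟩)
        · exact .inr (.inl ⟨.rfl, h.2⟩)
        · exact .inl h.2
      · rcases ih with h | h | h
        · exact .inr (.inr ⟨.rfl, h⟩)
        · exact .inl h.2
        · exact .inr (.inr ⟨.rfl, h.2⟩)
  · rintro (h | ⟨h, h'⟩ | ⟨h, h'⟩)
    · exact mono h
    · exact (mono h).trans (huv.trans (mono h'))
    · exact (mono h).trans (huv.symm.trans (mono h'))

lemma sep_sup_edge_left (G : SimpleGraph V) (u v z : V) :
    (G ⊔ edge u v).sep z u = G.sep z u * G.sep z v := by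
  have : (G ⊔ edge u v).Reachable z u ↔ G.Reachable z u ∨ G.Reachable z v := by
    rw [reachable_sup_edge_iff]
    constructor
    · tauto
    · rintro (h | h)
      · exact .inl h
      · exact .inr (.inr ⟨h, .rfl⟩)
  by_cases h : G.Reachable z u <;> simp [sep, this, h]

/-- Joining the components of `u` and `v` does not affect separation of the vertices outside. -/
lemma sep_sup_edge_mul (G : SimpleGraph V) (u v x y : V) :
    (G ⊔ edge u v).sep x y * (G.sep x u * G.sep x v) = G.sep x y * (G.sep x u * G.sep x v) := by
  by_cases hu : G.Reachable x u <;> by_cases hv : G.Reachable x v <;>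
    simp [sep, hu, hv, reachable_sup_edge_iff]

variable [Fintype V]

lemma sum_adjInd (G : SimpleGraph V) : ∑ u, ∑ v, G.adjInd u v = 2 * #G.edgeFinset := by
  have := congrArg (Nat.cast (R := ℝ)) G.two_mul_card_edgeFinset
  push_cast at this
  rw [this, card_filter, ← univ_product_univ, sum_product]
  simp [adjInd]

/-- The component of `z` in a forest has one edge less than it has vertices. -/
lemma IsAcyclic.sum_adjInd_mul_one_sub_sep (hG : G.IsAcyclic) (z : V) :
    ∑ u, ∑ v, G.adjInd u v * (1 - G.sep u z) = 2 * (∑ u, (1 - G.sep u z) - 1) := by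
  set c := G.connectedComponentMk z
  have hmem (u : V) : u ∈ c.supp ↔ G.Reachable u z := by simp [c]
  have hr (u : V) : 1 - G.sep u z = if u ∈ c.supp then 1 else 0 := by
    by_cases h : G.Reachable u z <;> simp [sep, hmem, h]
  have htree := (hG.isTree_connectedComponent c).card_edgeFinset
  have hsum := c.toSimpleGraph.sum_adjInd
  have hcard : ((#c.toSimpleGraph.edgeFinset : ℕ) : ℝ) = ∑ u, (1 - G.sep u z) - 1 := by
    rw [eq_sub_iff_add_eq]
    simp_rw [hr]
    rw [← sum_filter, sum_const, nsmul_one]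
    norm_cast
    rw [htree, Fintype.card_subtype]
    exact congrArg card (filter_congr fun _ _ ↦ Iff.rfl)
  rw [← hcard, ← hsum]
  have hsub (f : V → ℝ) : ∑ u : c, f u = ∑ u, if u ∈ c.supp then f u else 0 := by
    rw [← sum_filter]
    exact (sum_subtype _ (fun _ ↦ by simp only [mem_filter_univ]; rfl) f).symm
  have hadj (u : c) : ∑ v : c, c.toSimpleGraph.adjInd u v = ∑ v, G.adjInd u v := by
    calc _ = ∑ v : c, G.adjInd u v := rfl
      _ = _ := hsub _
      _ = _ := sum_congr rfl fun v _ ↦ by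
        have hu := (hmem _).1 u.2
        by_cases h : G.Adj u v
        · simp [(hmem v).2 (h.reachable.symm.trans hu)]
        · simp [adjInd, h]
  simp_rw [hadj]
  rw [hsub (fun u ↦ ∑ v, G.adjInd u v)]
  refine sum_congr rfl fun u _ ↦ ?_
  rw [hr, ← sum_mul]
  split_ifs <;> simp

lemma IsAcyclic.card_edgeFinset_lt [Nonempty V] (hG : G.IsAcyclic) :
    #G.edgeFinset < Fintype.card V := by
  obtain ⟨T, hGT, -, hT⟩ :=
    (connected_top (V := V)).exists_isTree_le_of_le_of_isAcyclic le_top hG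
  have := hT.card_edgeFinset
  have := card_le_card (edgeFinset_mono hGT)
  omega

/-- The forests on `V` with `|V| - k` edges, i.e. with `k` components. -/
def forests (V : Type*) [Fintype V] (k : ℕ) : Finset (SimpleGraph V) :=
  {G | G.IsAcyclic ∧ #G.edgeFinset + k = Fintype.card V}

lemma mem_forests {k : ℕ} :
    G ∈ forests V k ↔ G.IsAcyclic ∧ #G.edgeFinset + k = Fintype.card V := by
  simp [forests]

/-- Double counting of the pairs of a forest with `k` components and an oriented edge of it, against
the pairs of a forest with `k + 1` components and an oriented pair of separated vertices. -/
lemma sum_forests_sum_adjInd (k : ℕ) (φ : SimpleGraph V → V → V → ℝ) :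
    ∑ F ∈ forests V k, ∑ u, ∑ v, F.adjInd u v * φ F u v =
      ∑ G ∈ forests V (k + 1), ∑ u, ∑ v, G.sep u v * φ (G ⊔ edge u v) u v := by
  rw [sum_comm, sum_comm (s := forests V (k + 1))]
  refine sum_congr rfl fun u _ ↦ ?_
  rw [sum_comm, sum_comm (s := forests V (k + 1))]
  refine sum_congr rfl fun v _ ↦ ?_
  simp only [adjInd, sep, ite_mul, one_mul, zero_mul]
  rw [← sum_filter]
  simp_rw [← ite_not (p := SimpleGraph.Reachable _ u v)]
  rw [← sum_filter]
  have key {F : SimpleGraph V} (h : F.Adj u v) : F.deleteEdges {s(u, v)} ⊔ edge u v = F := by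
    ext a b
    have := h.symm
    have := F.ne_of_adj (a := a) (b := b)
    simp only [sup_adj, deleteEdges_adj, edge_adj]
    grind
  have card {F G : SimpleGraph V} (h : ¬ G.Reachable u v) (hF : G ⊔ edge u v = F) :
      #F.edgeFinset = #G.edgeFinset + 1 := by
    subst hF
    convert G.card_edgeFinset_sup_edge (fun h' ↦ h h'.reachable) (fun h' ↦ h (h' ▸ .rfl))
  refine sum_bij' (fun F _ ↦ F.deleteEdges {s(u, v)}) (fun G _ ↦ G ⊔ edge u v) ?_ ?_ ?_ ?_ ?_
  · intro F hF
    rw [mem_filter, mem_forests] at hF ⊢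
    obtain ⟨⟨hF, hk⟩, h⟩ := hF
    have hsep := isAcyclic_iff_forall_adj_isBridge.1 hF h
    rw [isBridge_iff] at hsep
    have := card hsep (key h)
    exact ⟨⟨hF.anti (deleteEdges_le _), by omega⟩, hsep⟩
  · intro G hG
    rw [mem_filter, mem_forests] at hG ⊢
    obtain ⟨⟨hG, hk⟩, h⟩ := hG
    refine ⟨⟨hG.sup_edge_of_not_reachable h, ?_⟩, ?_⟩
    · rw [card h rfl]; omega
    · have : u ≠ v := fun h' ↦ h (h' ▸ .rfl)
      simp [edge_adj, this]
  · intro F hF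
    exact key (mem_filter.1 hF).2
  · intro G hG
    have h : ¬ G.Adj u v := fun h ↦ (mem_filter.1 hG).2 h.reachable
    ext a b
    have := h ∘ Adj.symm
    simp only [sup_adj, deleteEdges_adj, edge_adj]
    grind
  · intro F hF
    rw [key (mem_filter.1 hF).2]

/-- The number of pairs of vertices in different components. -/
def sepPairs (G : SimpleGraph V) : ℝ := ∑ x, ∑ y, G.sep x y

/-- The number of triples of vertices in pairwise different components. -/
def sepTriples (G : SimpleGraph V) : ℝ :=
  ∑ x, ∑ y, ∑ z, G.sep x y * (G.sep x z * G.sep y z)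

/-- The number of quadruples of vertices in pairwise different components. -/
def sepQuads (G : SimpleGraph V) : ℝ :=
  ∑ x, ∑ y, ∑ z, ∑ w,
    G.sep x y * (G.sep x z * G.sep y z) * (G.sep x w * G.sep y w * G.sep z w)

/-- The number of vertices not connected to `z`. -/
def sepCount (G : SimpleGraph V) (z : V) : ℝ := ∑ y, G.sep y z

lemma sum_sep_eq_sepCount (G : SimpleGraph V) (z : V) : ∑ y, G.sep z y = G.sepCount z :=
  sum_congr rfl fun y _ ↦ G.sep_comm z y

lemma sum_sepCount (G : SimpleGraph V) : ∑ z, G.sepCount z = G.sepPairs := by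
  simp only [← sum_sep_eq_sepCount, sepPairs]

lemma sum_sep_mul_sepCount_add (G : SimpleGraph V) :
    ∑ x, ∑ y, G.sep x y * (G.sepCount x + G.sepCount y) =
      G.sepTriples + Fintype.card V * G.sepPairs := by
  simp_rw [sepTriples, sep_mul_sep_mul_sep, ← mul_sum, sum_sub_distrib, sum_add_distrib,
    sum_sep_eq_sepCount, mul_sub, sum_sub_distrib, ← sum_mul, sepPairs]
  simp [mul_comm]

lemma two_mul_sum_sep_mul_sepCount (G : SimpleGraph V) :
    2 * ∑ x, ∑ y, G.sep x y * G.sepCount y = G.sepTriples + Fintype.card V * G.sepPairs := by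
  have h : ∑ x, ∑ y, G.sep x y * G.sepCount x = ∑ x, ∑ y, G.sep x y * G.sepCount y := by
    rw [sum_comm]
    simp only [G.sep_comm]
  rw [← sum_sep_mul_sepCount_add]
  simp_rw [mul_add, sum_add_distrib, h]
  ring

lemma sum_sep_mul_sep_mul_sep_mul_sepCount (G : SimpleGraph V) :
    3 * ∑ x, ∑ y, ∑ z, G.sep x y * (G.sep x z * G.sep y z) * (G.sepCount x + G.sepCount y) =
      2 * (G.sepQuads + 2 * Fintype.card V * G.sepTriples) := by
  have hquad : G.sepQuads + 2 * Fintype.card V * G.sepTriples = ∑ x, ∑ y, ∑ z,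
      G.sep x y * (G.sep x z * G.sep y z) * (G.sepCount x + G.sepCount y + G.sepCount z) := by
    have key (x y z w : V) :
        G.sep x y * (G.sep x z * G.sep y z) * (G.sep x w * G.sep y w * G.sep z w) =
          G.sep x y * (G.sep x z * G.sep y z) * (G.sep x w + G.sep y w + G.sep z w - 2) := by
      linear_combination
        (G.sep x z * G.sep y z) * G.sep z w * G.sep_mul_sep_mul_sep x y w
        + (G.sep x y * G.sep y z) * G.sep_mul_sep_mul_sep x z w
        + (G.sep x y * G.sep x z) * G.sep_mul_sep_mul_sep y z w
    simp_rw [sepQuads, key, ← mul_sum, sum_sub_distrib, sum_add_distrib, sum_sep_eq_sepCount,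
      mul_sub, sum_sub_distrib, ← sum_mul, sepTriples]
    simp
    ring
  have hxy : ∑ x, ∑ y, ∑ z, G.sep x y * (G.sep x z * G.sep y z) * G.sepCount x =
      ∑ x, ∑ y, ∑ z, G.sep x y * (G.sep x z * G.sep y z) * G.sepCount y := by
    rw [sum_comm]
    refine sum_congr rfl fun x _ ↦ sum_congr rfl fun y _ ↦ sum_congr rfl fun z _ ↦ ?_
    rw [G.sep_comm y x]
    ring
  have hyz : ∑ x, ∑ y, ∑ z, G.sep x y * (G.sep x z * G.sep y z) * G.sepCount z =
      ∑ x, ∑ y, ∑ z, G.sep x y * (G.sep x z * G.sep y z) * G.sepCount y := by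
    refine sum_congr rfl fun x _ ↦ ?_
    rw [sum_comm]
    refine sum_congr rfl fun y _ ↦ sum_congr rfl fun z _ ↦ ?_
    rw [G.sep_comm z y]
    ring
  rw [hquad]
  simp_rw [mul_add, sum_add_distrib, hxy, hyz]
  ring

lemma sum_sum_mul_sum_comm (a : V → V → ℝ) (g : V → V → ℝ) :
    ∑ u, ∑ v, a u v * ∑ x, g x u = ∑ x, ∑ u, ∑ v, a u v * g x u := by
  simp_rw [← sum_mul, mul_sum]
  exact sum_comm

section ForestSide

variable {F : SimpleGraph V} {k : ℕ}

lemma sum_adjInd_of_mem_forests (hF : F ∈ forests V k) :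
    ∑ u, ∑ v, F.adjInd u v = 2 * (Fintype.card V - k) := by
  rw [sum_adjInd, ← (mem_forests.1 hF).2]
  push_cast
  ring

lemma sum_adjInd_mul_one_sub_sep_of_mem_forests (hF : F ∈ forests V k) (z : V) :
    ∑ u, ∑ v, F.adjInd u v * (1 - F.sep u z) = 2 * (Fintype.card V - 1 - F.sepCount z) := by
  rw [(mem_forests.1 hF).1.sum_adjInd_mul_one_sub_sep, sum_sub_distrib, sepCount]
  simp
  ring

lemma sum_adjInd_mul_sep (hF : F ∈ forests V k) (z : V) :
    ∑ u, ∑ v, F.adjInd u v * F.sep u z = 2 * (F.sepCount z + 1 - k) := by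
  have h := sum_adjInd_mul_one_sub_sep_of_mem_forests hF z
  simp_rw [mul_sub, mul_one, sum_sub_distrib, sum_adjInd_of_mem_forests hF] at h
  linarith

lemma sum_adjInd_mul_sum_sep (hF : F ∈ forests V k) :
    ∑ u, ∑ v, F.adjInd u v * ∑ z, F.sep z u = 2 * F.sepPairs - 2 * Fintype.card V * (k - 1) := by
  have : ∑ u, ∑ v, F.adjInd u v * ∑ z, F.sep z u =
      ∑ z, ∑ u, ∑ v, F.adjInd u v * F.sep u z := by
    rw [sum_sum_mul_sum_comm]
    exact sum_congr rfl fun z _ ↦ sum_congr rfl fun u _ ↦ by rw [F.sep_comm z u]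
  simp_rw [this, sum_adjInd_mul_sep hF, ← mul_sum, sum_sub_distrib, sum_add_distrib, sum_sepCount]
  simp
  ring

lemma sum_adjInd_mul_sum_sep_mul_sep (hF : F ∈ forests V k) :
    ∑ u, ∑ v, F.adjInd u v * ∑ x, ∑ y, F.sep x y * (F.sep x u * F.sep y u) =
      2 * F.sepTriples - 2 * (k - 2) * F.sepPairs := by
  have : ∑ u, ∑ v, F.adjInd u v * ∑ x, ∑ y, F.sep x y * (F.sep x u * F.sep y u) =
      ∑ x, ∑ y, F.sep x y *
        ∑ u, ∑ v, F.adjInd u v * (F.sep u x + F.sep u y - 1) := by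
    simp_rw [sum_sum_mul_sum_comm]
    refine sum_congr rfl fun x _ ↦ sum_congr rfl fun y _ ↦ ?_
    simp_rw [mul_sum]
    refine sum_congr rfl fun u _ ↦ sum_congr rfl fun v _ ↦ ?_
    rw [sep_mul_sep_mul_sep, F.sep_comm x u, F.sep_comm y u]
    ring
  have h := F.sum_sep_mul_sepCount_add
  have hsum (x y : V) : F.sep x y * ∑ u, ∑ v, F.adjInd u v * (F.sep u x + F.sep u y - 1) =
      2 * (F.sep x y * (F.sepCount x + F.sepCount y)) -
        2 * (Fintype.card V + k - 2) * F.sep x y := by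
    simp_rw [mul_sub, mul_add, mul_one, sum_sub_distrib, sum_add_distrib, sum_adjInd_mul_sep hF,
      sum_adjInd_of_mem_forests hF]
    ring
  simp_rw [this, hsum, sum_sub_distrib, ← mul_sum, h]
  rw [← sepPairs]
  ring

lemma sum_adjInd_mul_sum_sep_mul_one_sub_sep (hF : F ∈ forests V k) :
    ∑ u, ∑ v, F.adjInd u v * ∑ w, ∑ z, F.sep w u * (1 - F.sep z u) =
      (Fintype.card V - 2) * F.sepPairs - F.sepTriples := by
  have : ∑ u, ∑ v, F.adjInd u v * ∑ w, ∑ z, F.sep w u * (1 - F.sep z u) =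
      ∑ w, ∑ z, F.sep w z * ∑ u, ∑ v, F.adjInd u v * (1 - F.sep u z) := by
    simp_rw [sum_sum_mul_sum_comm]
    refine sum_congr rfl fun w _ ↦ sum_congr rfl fun z _ ↦ ?_
    simp_rw [mul_sum]
    refine sum_congr rfl fun u _ ↦ sum_congr rfl fun v _ ↦ ?_
    rw [sep_mul_one_sub_sep]
    ring
  have h := F.two_mul_sum_sep_mul_sepCount
  have hsum (w z : V) : F.sep w z * (2 * (Fintype.card V - 1 - F.sepCount z)) =
      2 * (Fintype.card V - 1) * F.sep w z - 2 * (F.sep w z * F.sepCount z) := by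
    ring
  simp_rw [this, sum_adjInd_mul_one_sub_sep_of_mem_forests hF, hsum, sum_sub_distrib, ← mul_sum, h]
  rw [← sepPairs]
  ring

end ForestSide

lemma sum_sep_mul_sum_sep_sup_edge (G : SimpleGraph V) :
    ∑ u, ∑ v, G.sep u v * ∑ z, (G ⊔ edge u v).sep z u = G.sepTriples := by
  simp_rw [sep_sup_edge_left, mul_sum, sepTriples, G.sep_comm]

lemma sum_sep_mul_sum_sep_sup_edge_mul (G : SimpleGraph V) :
    ∑ u, ∑ v, G.sep u v * ∑ x, ∑ y, (G ⊔ edge u v).sep x y *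
      ((G ⊔ edge u v).sep x u * (G ⊔ edge u v).sep y u) = G.sepQuads := by
  simp_rw [mul_sum, sepQuads]
  refine sum_congr rfl fun u _ ↦ sum_congr rfl fun v _ ↦ sum_congr rfl fun x _ ↦
    sum_congr rfl fun y _ ↦ ?_
  rw [sep_sup_edge_left, sep_sup_edge_left, G.sep_comm u x, G.sep_comm v x, G.sep_comm u y,
    G.sep_comm v y]
  linear_combination G.sep u v * (G.sep y u * G.sep y v) * G.sep_sup_edge_mul u v x y

lemma sum_sep_mul_sum_sep_sup_edge_mul_one_sub (G : SimpleGraph V) :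
    3 * ∑ u, ∑ v, G.sep u v * ∑ w, ∑ z, (G ⊔ edge u v).sep w u * (1 - (G ⊔ edge u v).sep z u) =
      2 * (Fintype.card V * G.sepTriples - G.sepQuads) := by
  have key (u v : V) : G.sep u v * ∑ w, ∑ z,
      (G ⊔ edge u v).sep w u * (1 - (G ⊔ edge u v).sep z u) =
      ∑ w, G.sep u v * (G.sep u w * G.sep v w) *
        (2 * Fintype.card V - (G.sepCount u + G.sepCount v)) := by
    simp_rw [mul_sum]
    refine sum_congr rfl fun w _ ↦ ?_
    have (z : V) : G.sep u v * ((G ⊔ edge u v).sep w u * (1 - (G ⊔ edge u v).sep z u)) =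
        G.sep u v * (G.sep u w * G.sep v w) * (2 - (G.sep z u + G.sep z v)) := by
      rw [sep_sup_edge_left, sep_sup_edge_left, G.sep_comm w u, G.sep_comm w v, G.sep_comm z u,
        G.sep_comm z v]
      linear_combination -(G.sep u w * G.sep v w) * G.sep_mul_sep_mul_sep u v z
    simp_rw [this, ← mul_sum, sum_sub_distrib, sum_add_distrib]
    simp [sepCount, mul_comm]
  have h := G.sum_sep_mul_sep_mul_sep_mul_sepCount
  simp_rw [key, mul_sub, sum_sub_distrib, ← sum_mul] at h ⊢
  rw [← sepTriples]
  linarith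

lemma sum_forests_sepPairs_succ (V : Type*) [Fintype V] (k : ℕ) :
    ∑ G ∈ forests V (k + 1), G.sepPairs = 2 * (Fintype.card V - k) * #(forests V k) := by
  have h := sum_forests_sum_adjInd (V := V) k fun _ _ _ ↦ 1
  simp only [mul_one] at h
  simp only [sepPairs]
  rw [← h, sum_congr rfl fun F hF ↦ sum_adjInd_of_mem_forests hF, sum_const, nsmul_eq_mul]
  ring

lemma sum_forests_sepTriples_succ (V : Type*) [Fintype V] (k : ℕ) :
    ∑ G ∈ forests V (k + 1), G.sepTriples =
      2 * ∑ F ∈ forests V k, F.sepPairs - 2 * Fintype.card V * (k - 1) * #(forests V k) := by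
  have h := sum_forests_sum_adjInd (V := V) k fun F u _ ↦ ∑ z, F.sep z u
  simp only [sum_sep_mul_sum_sep_sup_edge] at h
  rw [← h, sum_congr rfl fun F hF ↦ sum_adjInd_mul_sum_sep hF, sum_sub_distrib, sum_const,
    nsmul_eq_mul, mul_sum]
  ring

lemma sum_forests_sepQuads_succ (V : Type*) [Fintype V] (k : ℕ) :
    ∑ G ∈ forests V (k + 1), G.sepQuads =
      2 * ∑ F ∈ forests V k, F.sepTriples - 2 * (k - 2) * ∑ F ∈ forests V k, F.sepPairs := by
  have h := sum_forests_sum_adjInd (V := V) k fun F u _ ↦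
    ∑ x, ∑ y, F.sep x y * (F.sep x u * F.sep y u)
  simp only [sum_sep_mul_sum_sep_sup_edge_mul] at h
  rw [← h, sum_congr rfl fun F hF ↦ sum_adjInd_mul_sum_sep_mul_sep hF, sum_sub_distrib, mul_sum,
    mul_sum]

lemma sum_forests_sepTriples_sub_sepQuads_succ (V : Type*) [Fintype V] (k : ℕ) :
    2 * (Fintype.card V * ∑ G ∈ forests V (k + 1), G.sepTriples -
        ∑ G ∈ forests V (k + 1), G.sepQuads) =
      3 * ((Fintype.card V - 2) * ∑ F ∈ forests V k, F.sepPairs -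
        ∑ F ∈ forests V k, F.sepTriples) := by
  have h := sum_forests_sum_adjInd (V := V) k fun F u _ ↦
    ∑ w, ∑ z, F.sep w u * (1 - F.sep z u)
  rw [sum_congr rfl fun F hF ↦ sum_adjInd_mul_sum_sep_mul_one_sub_sep hF, sum_sub_distrib,
    ← mul_sum] at h
  rw [h, mul_sum (s := forests V (k + 1)), mul_sum, ← sum_sub_distrib, mul_sum]
  simp_rw [sum_sep_mul_sum_sep_sup_edge_mul_one_sub]

lemma forests_zero (V : Type*) [Fintype V] [Nonempty V] : forests V 0 = ∅ := by
  refine eq_empty_of_forall_notMem fun F hF ↦ ?_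
  obtain ⟨hF, hcard⟩ := mem_forests.1 hF
  have := hF.card_edgeFinset_lt
  omega

lemma sum_forests_one_sepPairs (V : Type*) [Fintype V] [Nonempty V] :
    ∑ F ∈ forests V 1, F.sepPairs = 0 := by
  rw [sum_forests_sepPairs_succ V 0, forests_zero]
  simp

lemma card_forests_two (V : Type*) [Fintype V] [Nonempty V] :
    2 * (Fintype.card V : ℝ) ^ 2 * #(forests V 2) =
      (Fintype.card V - 1) * (Fintype.card V + 6) * #(forests V 1) := by
  have p2 := sum_forests_sepPairs_succ V 1
  have t2 := sum_forests_sepTriples_succ V 1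
  have t3 := sum_forests_sepTriples_succ V 2
  have q3 := sum_forests_sepQuads_succ V 2
  have r3 := sum_forests_sepTriples_sub_sepQuads_succ V 2
  rw [sum_forests_one_sepPairs] at t2
  norm_num at p2 t2 t3 q3 r3
  rw [t2] at q3 r3
  rw [q3, t3, p2] at r3
  linear_combination -r3 / 2

lemma card_forests_three (V : Type*) [Fintype V] [Nonempty V] :
    8 * (Fintype.card V : ℝ) ^ 4 * #(forests V 3) = (Fintype.card V - 1) * (Fintype.card V - 2) *
      ((Fintype.card V : ℝ) ^ 2 + 13 * Fintype.card V + 60) * #(forests V 1) := by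
  have f2 := card_forests_two V
  have p2 := sum_forests_sepPairs_succ V 1
  have p3 := sum_forests_sepPairs_succ V 2
  have t3 := sum_forests_sepTriples_succ V 2
  have t4 := sum_forests_sepTriples_succ V 3
  have q4 := sum_forests_sepQuads_succ V 3
  have r4 := sum_forests_sepTriples_sub_sepQuads_succ V 3
  norm_num at p2 p3 t3 t4 q4 r4
  rw [q4, t4, t3, p3, p2] at r4
  linear_combination -(Fintype.card V : ℝ) ^ 2 * r4 +
    ((Fintype.card V : ℝ) ^ 2 + 9 * Fintype.card V - 20) * f2

lemma disjoint_forests {j k : ℕ} (h : j ≠ k) : Disjoint (forests V j) (forests V k) := by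
  rw [Finset.disjoint_left]
  intro F hj hk
  have := (mem_forests.1 hj).2
  have := (mem_forests.1 hk).2
  omega

lemma ncard_isTree_le (V : Type*) [Fintype V] :
    {T : SimpleGraph V | T.IsTree}.ncard ≤ #(forests V 1) := by
  rw [← Set.ncard_coe_finset]
  exact Set.ncard_le_ncard fun T hT ↦ mem_coe.2 (mem_forests.2 ⟨hT.isAcyclic, hT.card_edgeFinset⟩)

lemma card_forests_add_le_ncard_isAcyclic (V : Type*) [Fintype V] :
    #(forests V 1) + #(forests V 2) + #(forests V 3) ≤
      {F : SimpleGraph V | F.IsAcyclic}.ncard := by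
  rw [← card_union_of_disjoint (disjoint_forests (by decide)), ← card_union_of_disjoint
    (disjoint_union_left.2 ⟨disjoint_forests (by decide), disjoint_forests (by decide)⟩),
    ← Set.ncard_coe_finset]
  refine Set.ncard_le_ncard fun F hF ↦ ?_
  simp only [coe_union, Set.mem_union, mem_coe, mem_forests] at hF
  exact hF.elim (fun h ↦ h.elim (·.1) (·.1)) (·.1)

lemma thirteen_mul_ncard_isTree_le (V : Type*) [Fintype V] (hV : 2 ≤ Fintype.card V) :
    13 * ({T : SimpleGraph V | T.IsTree}.ncard : ℝ) ≤
      8 * ({F : SimpleGraph V | F.IsAcyclic}.ncard : ℝ) := by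
  have : Nonempty V := Fintype.card_pos_iff.1 (by omega)
  have h1 : ({T : SimpleGraph V | T.IsTree}.ncard : ℝ) ≤ #(forests V 1) :=
    mod_cast ncard_isTree_le V
  have h2 : (#(forests V 1) + #(forests V 2) + #(forests V 3) : ℝ) ≤
      {F : SimpleGraph V | F.IsAcyclic}.ncard := mod_cast card_forests_add_le_ncard_isAcyclic V
  have f2 := card_forests_two V
  have f3 := card_forests_three V
  have hn : (2 : ℝ) ≤ Fintype.card V := mod_cast hV
  set n := (Fintype.card V : ℝ)
  have hpoly : 0 ≤ 30 * n ^ 3 - n ^ 2 - 154 * n + 120 := by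
    nlinarith [mul_nonneg (sub_nonneg.2 hn) (sub_nonneg.2 hn), pow_nonneg (sub_nonneg.2 hn) 3]
  suffices 5 * (#(forests V 1) : ℝ) ≤ 8 * #(forests V 2) + 8 * #(forests V 3) by linarith
  have hn4 : 0 < n ^ 4 := by positivity
  refine le_of_mul_le_mul_left ?_ hn4
  have := mul_nonneg hpoly (Nat.cast_nonneg (α := ℝ) #(forests V 1))
  linear_combination this - 4 * n ^ 2 * f2 - f3

end

end SimpleGraph

theorem forest_connected_prob_lt_exp_048 (n : ℕ) (hn : 2 ≤ n) :
    (treeCount n : ℝ) / (forestCount n : ℝ) < Real.exp (-0.48) := by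
  have h := SimpleGraph.thirteen_mul_ncard_isTree_le (Fin n) (by simpa using hn)
  have hexp : Real.exp 0.48 < 13 / 8 := by
    have := Real.exp_bound' (x := 0.48) (by norm_num) (by norm_num) (n := 5) (by norm_num)
    norm_num [Finset.sum_range_succ, Nat.factorial] at this
    norm_num
    linarith
  calc (treeCount n : ℝ) / (forestCount n : ℝ) ≤ 8 / 13 := by
        refine div_le_of_le_mul₀ (by positivity) (by positivity) ?_
        rw [treeCount, forestCount]
        linarith
    _ = (13 / 8)⁻¹ := by norm_num
    _ < Real.exp (-0.48) := by
        rw [Real.exp_neg]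
        exact inv_strictAnti₀ (Real.exp_pos _) hexp
end

section
/- For every integer n ≥ 2, the number of forests on vertex set {1,…,n} satisfies |ℱₙ| > n^{n-2} · Σ_{j=0}^{6} |ℱ_j|/(j!·e^j), where |ℱ_0|,…,|ℱ_6| = 1, 1, 2, 7, 38, 291, 2932 are the numbers of forests on 0,…,6 labelled vertices. -/
open Finset

namespace SimpleGraph

variable {V W : Type*}

/-- `G` is a forest in which distinct vertices of `S` lie in distinct components. -/
def IsSeparatedForest (G : SimpleGraph V) (S : Set V) : Prop :=
  G.IsAcyclic ∧ S.Pairwise fun x y ↦ ¬ G.Reachable x y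

/-- The number of forests on `V` in which distinct vertices of `S` lie in distinct components. -/
noncomputable def separatedForestCount (S : Finset V) : ℕ :=
  Nat.card {G : SimpleGraph V // G.IsSeparatedForest S}

/-- The graph obtained from `G` by adding a new vertex `none` adjacent to the vertices of `N`. -/
def cone (N : Set V) (G : SimpleGraph V) : SimpleGraph (Option V) where
  Adj
    | none, none => False
    | none, some v => v ∈ N
    | some v, none => v ∈ N
    | some v, some w => G.Adj v w
  symm := ⟨by rintro (_ | v) (_ | w) h <;> first | exact h | exact G.adj_symm h⟩
  loopless := ⟨by rintro (_ | v) h <;> first | exact h | exact G.irrefl h⟩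

@[simp] lemma cone_adj_none_some {N : Set V} {G : SimpleGraph V} {v : V} :
    (cone N G).Adj none (some v) ↔ v ∈ N := Iff.rfl

@[simp] lemma cone_adj_some_none {N : Set V} {G : SimpleGraph V} {v : V} :
    (cone N G).Adj (some v) none ↔ v ∈ N := Iff.rfl

@[simp] lemma cone_adj_some_some {N : Set V} {G : SimpleGraph V} {v w : V} :
    (cone N G).Adj (some v) (some w) ↔ G.Adj v w := Iff.rfl

/-- Every graph on `Option V` is the cone over a unique graph on `V`. -/
noncomputable def coneEquiv [Fintype V] :
    Finset V × SimpleGraph V ≃ SimpleGraph (Option V) := by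
  classical
  exact
  { toFun := fun p ↦ cone p.1 p.2
    invFun := fun H ↦ (univ.filter fun v ↦ H.Adj none (some v), H.comap some)
    left_inv := fun p ↦ by ext <;> simp
    right_inv := fun H ↦ by
      ext x y
      rcases x with _ | x <;> rcases y with _ | y <;> simp [adj_comm] }

/-- A set closed under adjacency contains everything reachable from it. -/
lemma Reachable.mem_of_closed {G : SimpleGraph V} {C : Set V}
    (hC : ∀ ⦃x y⦄, x ∈ C → G.Adj x y → y ∈ C) {x y : V} (h : G.Reachable x y) (hx : x ∈ C) :
    y ∈ C := by
  rw [reachable_iff_reflTransGen] at h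
  induction h with
  | refl => exact hx
  | tail _ hadj ih => exact hC ih hadj

/-- A component of `G` that avoids the neighbours of the apex is still a component of the cone;
here some edges of the cone may be removed. -/
lemma reachable_of_reachable_some {G : SimpleGraph V} {H : SimpleGraph (Option V)} {x : V}
    (hsome : ∀ v w, H.Adj (some v) (some w) → G.Adj v w)
    (hnone : ∀ v, G.Reachable x v → ¬ H.Adj (some v) none) {z : Option V}
    (h : H.Reachable (some x) z) : ∃ v, z = some v ∧ G.Reachable x v := by
  refine h.mem_of_closed (C := {z | ∃ v, z = some v ∧ G.Reachable x v}) ?_ ⟨x, rfl, .rfl⟩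
  rintro _ (_ | w) ⟨v, rfl, hv⟩ hadj
  · exact absurd hadj (hnone v hv)
  · exact ⟨w, rfl, hv.trans (hsome v w hadj).reachable⟩

lemma isSeparatedForest_cone_iff {N S : Set V} {G : SimpleGraph V} :
    (cone N G).IsSeparatedForest (insert none (some '' S)) ↔
      Disjoint N S ∧ G.IsSeparatedForest (S ∪ N) := by
  have hmap {x y : V} (h : G.Reachable x y) : (cone N G).Reachable (some x) (some y) :=
    h.map (⟨some, id⟩ : G →g cone N G)
  constructor
  · rintro ⟨hac, hsep⟩
    have hnone {x : V} (hx : x ∈ S) : ¬ (cone N G).Reachable (some x) none :=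
      hsep (Or.inr ⟨x, hx, rfl⟩) (Or.inl rfl) (by simp)
    refine ⟨Set.disjoint_left.2 fun x hN hS ↦ hnone hS (Adj.reachable hN), ?_, ?_⟩
    · exact hac.comap (⟨some, id⟩ : G →g cone N G) (Option.some_injective V)
    · rintro x (hx | hx) y (hy | hy) hxy h
      · exact hsep (Or.inr ⟨x, hx, rfl⟩) (Or.inr ⟨y, hy, rfl⟩) (by simpa using hxy) (hmap h)
      · exact hnone hx ((hmap h).trans (Adj.reachable hy))
      · exact hnone hy ((hmap h.symm).trans (Adj.reachable hx))
      · have hb := isAcyclic_iff_forall_adj_isBridge.1 hac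
          (show (cone N G).Adj none (some x) from hx)
        rw [isBridge_iff] at hb
        refine hb (Reachable.trans (v := some y) (Adj.reachable ?_) (h.symm.map ⟨some, ?_⟩))
        · simpa [deleteEdges_adj, hy] using hxy.symm
        · intro v w hvw
          simpa [deleteEdges_adj] using hvw
  · rintro ⟨hdisj, hac, hsep⟩
    have heq {x y : V} (hx : x ∈ S ∪ N) (hy : y ∈ S ∪ N) (h : G.Reachable x y) : x = y := by
      by_contra hne
      exact hsep hx hy hne h
    refine ⟨isAcyclic_iff_forall_adj_isBridge.2 ?_, ?_⟩
    · have hapex {x : V} (hx : x ∈ N) : (cone N G).IsBridge s(some x, none) := by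
        rw [isBridge_iff]
        intro h
        obtain ⟨v, hv, -⟩ := reachable_of_reachable_some (G := G)
          (fun v w hvw ↦ by simpa [deleteEdges_adj] using hvw)
          (fun v hv hadj ↦ by
            simp only [deleteEdges_adj, cone_adj_some_none, Set.mem_singleton_iff] at hadj
            exact hadj.2 (by rw [heq (Or.inr hx) (Or.inr hadj.1) hv])) h
        cases hv
      rintro (_ | u) (_ | v) hadj
      · exact hadj.elim
      · rw [Sym2.eq_swap]
        exact hapex hadj
      · exact hapex hadj
      · have hb := isAcyclic_iff_forall_adj_isBridge.1 hac hadj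
        have key {a b : V} (hsym : s(a, b) = s(u, v))
            (hN : ∀ w, (G.deleteEdges {s(u, v)}).Reachable a w → w ∉ N) :
            (cone N G).IsBridge s(some a, some b) := by
          rw [isBridge_iff]
          intro h
          obtain ⟨w, hw, hr⟩ := reachable_of_reachable_some (G := G.deleteEdges {s(u, v)})
            (fun c d hcd ↦ by
              rw [← hsym]
              simpa [deleteEdges_adj] using hcd)
            (fun c hc hcd ↦ hN c hc (by simpa [deleteEdges_adj] using hcd)) h
          cases hw
          rw [← hsym, isBridge_iff, hsym] at hb
          exact hb hr
        by_cases hN : ∀ w, (G.deleteEdges {s(u, v)}).Reachable u w → w ∉ N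
        · exact key rfl hN
        · push Not at hN
          obtain ⟨w, hw, hwN⟩ := hN
          rw [Sym2.eq_swap]
          refine key Sym2.eq_swap fun w' hw' hwN' ↦ ?_
          have hle := G.deleteEdges_le {s(u, v)}
          have : w = w' := heq (Or.inr hwN) (Or.inr hwN')
            (((hw.mono hle).symm.trans (Adj.reachable hadj)).trans (hw'.mono hle))
          subst this
          exact hb (hw.trans hw'.symm)
    · have hout {x : V} (hx : x ∈ S) {z : Option V} (h : (cone N G).Reachable (some x) z) :
          ∃ v, z = some v ∧ G.Reachable x v :=
        reachable_of_reachable_some (fun _ _ ↦ id) (fun v hv hadj ↦ by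
          obtain rfl := heq (Or.inl hx) (Or.inr hadj) hv
          exact Set.disjoint_left.1 hdisj hadj hx) h
      rintro _ (rfl | ⟨x, hx, rfl⟩) _ (rfl | ⟨y, hy, rfl⟩) hne h
      · exact hne rfl
      · obtain ⟨v, hv, -⟩ := hout hy h.symm
        cases hv
      · obtain ⟨v, hv, -⟩ := hout hx h
        cases hv
      · obtain ⟨v, hv, hr⟩ := hout hx h
        cases hv
        exact hne (by rw [heq (Or.inl hx) (Or.inl hy) hr])

lemma separatedForestCount_map (e : V ≃ W) (S : Finset V) :
    separatedForestCount (S.map e.toEmbedding) = separatedForestCount S := by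
  refine (Nat.card_congr (e.simpleGraph.subtypeEquiv fun G ↦ ?_)).symm
  let φ : G ≃g e.simpleGraph G := ⟨e, by simp [Equiv.simpleGraph]⟩
  have hr (x y : V) : (e.simpleGraph G).Reachable (e x) (e y) ↔ G.Reachable x y :=
    Iso.reachable_iff (φ := φ)
  rw [IsSeparatedForest, IsSeparatedForest, φ.isAcyclic_iff, coe_map,
    e.toEmbedding.injective.injOn.pairwise_image]
  simp only [Set.Pairwise, Function.onFun, Equiv.coe_toEmbedding, hr]

lemma separatedForestCount_insertNone [Fintype V] [DecidableEq V] (S : Finset V) :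
    separatedForestCount S.insertNone = ∑ N ∈ Sᶜ.powerset, separatedForestCount (S ∪ N) := by
  classical
  have hS : ((S.insertNone : Finset (Option V)) : Set (Option V)) =
      insert none (some '' (S : Set V)) := by
    ext (_ | v) <;> simp
  have hcard : separatedForestCount S.insertNone = Nat.card {p : Finset V × SimpleGraph V //
      Disjoint p.1 S ∧ p.2.IsSeparatedForest ((S ∪ p.1 : Finset V) : Set V)} :=
    (Nat.card_congr (coneEquiv.subtypeEquiv fun p ↦ by
      rw [hS]
      simpa [coneEquiv] using
        (isSeparatedForest_cone_iff (N := (p.1 : Set V)) (S := S) (G := p.2)).symm)).symm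
  rw [hcard, Nat.card_eq_fintype_card, Fintype.card_subtype, card_filter,
    ← univ_product_univ, sum_product]
  have hpow : Sᶜ.powerset = univ.filter (Disjoint · S) := by
    ext N
    simp [subset_compl_iff_disjoint_right]
  rw [hpow, sum_filter]
  refine sum_congr rfl fun N _ ↦ ?_
  split_ifs with hN
  · simp [hN, separatedForestCount, Nat.card_eq_fintype_card, Fintype.card_subtype]
  · simp [hN]

/-- The number `k * (k + d) ^ (d - 1)` of forests on `k + d` vertices, `k` of which are roots, in
which every component contains exactly one root. -/
noncomputable def rootedForestCount (k d : ℕ) : ℝ :=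
  if k + d = 0 then 1 else k * (k + d : ℝ) ^ d / (k + d)

lemma rootedForestCount_zero_left (d : ℕ) :
    rootedForestCount 0 d = if d = 0 then 1 else 0 := by
  simp [rootedForestCount]

lemma rootedForestCount_one_left (d : ℕ) :
    rootedForestCount 1 d = (d + 1 : ℝ) ^ d / (d + 1) := by
  simp [rootedForestCount, add_comm]

/-- Removing a root turns its neighbours into roots. -/
lemma rootedForestCount_succ_left (k d : ℕ) :
    rootedForestCount (k + 1) d =
      ∑ i ∈ range (d + 1), d.choose i * rootedForestCount (k + i) (d - i) := by
  obtain h0 | h0 := eq_or_ne (k + d) 0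
  · obtain ⟨rfl, rfl⟩ : k = 0 ∧ d = 0 := by lia
    simp [rootedForestCount]
  set x : ℝ := k + d with hx
  have hx0 : x ≠ 0 := by
    rw [hx]
    exact_mod_cast h0
  have hx1 : x + 1 ≠ 0 := by
    rw [hx]
    positivity
  have hterm : ∀ i ∈ range (d + 1), (d.choose i : ℝ) * rootedForestCount (k + i) (d - i) =
      (k / x) * (x ^ (d - i) * d.choose i) + (i * d.choose i) * x ^ (d - i) / x := by
    intro i hi
    have hid : i ≤ d := by simpa [Nat.lt_succ_iff] using hi
    have hsum : ((k + i : ℕ) : ℝ) + ((d - i : ℕ) : ℝ) = x := by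
      rw [hx]
      push_cast [Nat.cast_sub hid]
      ring
    rw [rootedForestCount, if_neg (by lia), hsum]
    push_cast
    ring
  have hbinom (l : ℕ) : ∑ i ∈ range (l + 1), x ^ (l - i) * (l.choose i : ℝ) = (x + 1) ^ l := by
    rw [add_comm x 1, add_pow]
    simp
  have hderiv : (∑ i ∈ range (d + 1), ((i : ℝ) * d.choose i) * x ^ (d - i)) * (x + 1) =
      d * (x + 1) ^ d := by
    cases d with
    | zero => simp
    | succ d =>
      rw [sum_range_succ', pow_succ, ← mul_assoc, ← hbinom, mul_sum]
      simp only [CharP.cast_eq_zero, zero_mul, add_zero]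
      congr 1
      refine sum_congr rfl fun i _ ↦ ?_
      have hc : ((i + 1 : ℕ) : ℝ) * (d + 1).choose (i + 1) = (d + 1 : ℕ) * d.choose i := by
        have := Nat.add_one_mul_choose_eq d i
        rw [mul_comm ((i + 1 : ℕ) : ℝ)]
        exact_mod_cast this.symm
      rw [hc, Nat.add_sub_add_right]
      ring
  rw [sum_congr rfl hterm, sum_add_distrib, ← mul_sum, hbinom, ← sum_div,
    eq_div_of_mul_eq hx1 hderiv, rootedForestCount, if_neg (by lia)]
  have hsum : ((k + 1 : ℕ) : ℝ) + d = x + 1 := by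
    rw [hx]
    push_cast
    ring
  rw [hsum]
  have hk : (k : ℝ) = x - d := by
    rw [hx]
    ring
  push_cast
  rw [hk]
  field_simp
  ring

lemma separatedForestCount_empty [Fintype V] :
    separatedForestCount (∅ : Finset V) = forestCount (Fintype.card V) := by
  rw [← separatedForestCount_map (Fintype.equivFin V)]
  simp [separatedForestCount, IsSeparatedForest, forestCount, ← Nat.card_coe_set_eq,
    Set.coe_ofPred]

lemma separatedForestCount_singleton (v : V) :
    separatedForestCount ({v} : Finset V) = separatedForestCount (∅ : Finset V) := by
  simp [separatedForestCount, IsSeparatedForest]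

/-- Split a separated forest into the components meeting `S` and the remaining ones. -/
lemma separatedForestCount_eq_sum [Fintype V] (S : Finset V) (d : ℕ)
    (hd : Fintype.card V = #S + d) :
    (separatedForestCount S : ℝ) =
      ∑ j ∈ range (d + 1), d.choose j * forestCount j * rootedForestCount #S (d - j) := by
  classical
  induction hn : Fintype.card V generalizing V d with
  | zero =>
    obtain rfl : d = 0 := by lia
    obtain rfl : S = ∅ := card_eq_zero.1 (by lia)
    simp [separatedForestCount_empty, hn, rootedForestCount]
  | succ n ih =>
    obtain rfl | ⟨s, hs⟩ := S.eq_empty_or_nonempty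
    · have hdn : Fintype.card V = d := by simpa using hd
      rw [separatedForestCount_empty, hdn, sum_range_succ, sum_eq_zero]
      · simp [rootedForestCount]
      · intro j hj
        have : d - j ≠ 0 := by
          have := mem_range.1 hj
          lia
        simp [rootedForestCount_zero_left, this]
    · set T : Finset {v // v ≠ s} := S.subtype (· ≠ s) with hT
      have hST : T.insertNone.map (Equiv.optionSubtypeNe s).toEmbedding = S := by
        ext v
        obtain rfl | hv := eq_or_ne v s
        · simpa using hs
        · simp [hT, hv]
      have hcS : #S = #T + 1 := by
        rw [← hST]
        simp
      have hcW : Fintype.card {v // v ≠ s} = n := by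
        simp [Fintype.card_subtype_compl, hn]
      have hcT : #Tᶜ = d := by
        rw [card_compl]
        lia
      have hrec : ∀ N ∈ Tᶜ.powerset, (separatedForestCount (T ∪ N) : ℝ) =
          ∑ j ∈ range (d - #N + 1), (d - #N).choose j * forestCount j *
            rootedForestCount (#T + #N) (d - #N - j) := by
        intro N hN
        have hNT := mem_powerset.1 hN
        have hcN := card_le_card hNT
        have hunion : #(T ∪ N) = #T + #N :=
          card_union_of_disjoint (subset_compl_iff_disjoint_right.1 hNT).symm
        rw [ih (T ∪ N) (d - #N) (by lia) hcW, hunion]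
      rw [← hST, separatedForestCount_map, separatedForestCount_insertNone, hST, Nat.cast_sum,
        sum_congr rfl hrec, sum_powerset_apply_card (fun i ↦
          ∑ j ∈ range (d - i + 1), ((d - i).choose j : ℝ) * forestCount j *
            rootedForestCount (#T + i) (d - i - j)), hcT, hcS]
      simp only [rootedForestCount_succ_left, mul_sum, nsmul_eq_mul]
      rw [sum_comm' (t' := range (d + 1)) (s' := fun j ↦ range (d - j + 1))
        (by simp only [mem_range]; lia)]
      refine sum_congr rfl fun j hj ↦ sum_congr rfl fun i hi ↦ ?_
      rw [mem_range] at hi hj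
      have hc : (d.choose i : ℝ) * (d - i).choose j = d.choose j * (d - j).choose i := by
        have h1 := Nat.choose_mul (n := d) (k := i + j) (s := i) (by lia)
        have h2 := Nat.choose_mul (n := d) (k := i + j) (s := j) (by lia)
        rw [Nat.choose_symm_add, h2] at h1
        simp only [Nat.add_sub_cancel, Nat.add_sub_cancel_left] at h1
        exact_mod_cast h1.symm
      rw [Nat.sub_right_comm]
      linear_combination forestCount j * rootedForestCount (#T + i) (d - j - i) * hc

end SimpleGraph

/-- Remove the component of a fixed vertex. -/
lemma forestCount_succ (m : ℕ) :
    (forestCount (m + 1) : ℝ) =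
      ∑ j ∈ range (m + 1),
        m.choose j * forestCount j * ((m - j + 1 : ℝ) ^ (m - j) / (m - j + 1)) := by
  have h := SimpleGraph.separatedForestCount_eq_sum ({0} : Finset (Fin (m + 1))) m
    (by simp [add_comm])
  rw [SimpleGraph.separatedForestCount_singleton, SimpleGraph.separatedForestCount_empty,
    Fintype.card_fin] at h
  rw [h]
  refine sum_congr rfl fun j hj ↦ ?_
  rw [card_singleton, SimpleGraph.rootedForestCount_one_left,
    Nat.cast_sub (Nat.lt_succ_iff.1 (mem_range.1 hj))]

lemma add_two_pow_lt_exp_mul (t : ℕ) : (t + 2 : ℝ) ^ t < Real.exp 1 * (t + 1 : ℝ) ^ t := by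
  have ht : (0 : ℝ) < t + 1 := by positivity
  calc (t + 2 : ℝ) ^ t = (1 / (t + 1) + 1) ^ t * (t + 1 : ℝ) ^ t := by
        rw [← mul_pow]
        congr 1
        field_simp
        ring
    _ ≤ Real.exp (1 / (t + 1)) ^ t * (t + 1 : ℝ) ^ t := by
        gcongr
        exact Real.add_one_le_exp _
    _ < Real.exp 1 * (t + 1 : ℝ) ^ t := by
        gcongr
        rw [← Real.exp_nat_mul, Real.exp_lt_exp, mul_one_div, div_lt_one ht]
        linarith

lemma choose_mul_pow_lt {m j : ℕ} (hj : j + 1 ≤ m) :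
    m.choose j * ((m - j + 1 : ℝ) ^ (m - j) / (m - j + 1)) <
      m.choose (j + 1) * ((m - (j + 1 : ℕ) + 1 : ℝ) ^ (m - (j + 1)) / (m - (j + 1 : ℕ) + 1)) *
        ((j + 1) * Real.exp 1) := by
  obtain ⟨t, rfl⟩ : ∃ t, m = j + 1 + t := ⟨m - (j + 1), by lia⟩
  have hc : ((j + 1 + t).choose (j + 1) : ℝ) * (j + 1) = (j + 1 + t).choose j * (t + 1) := by
    have := Nat.choose_succ_right_eq (j + 1 + t) j
    rw [show j + 1 + t - j = t + 1 by lia] at this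
    exact_mod_cast this
  have hpos : (0 : ℝ) < (j + 1 + t).choose j := by
    exact_mod_cast Nat.choose_pos (by lia)
  have h1 : (j + 1 + t : ℕ) - j = t + 1 := by lia
  have h2 : (j + 1 + t : ℕ) - (j + 1) = t := by lia
  have e1 : (j + 1 + t : ℝ) - j + 1 = t + 2 := by ring
  have e2 : (j + 1 + t : ℝ) - (j + 1) + 1 = t + 1 := by ring
  rw [h1, h2]
  push_cast
  rw [e1, e2, pow_succ, mul_div_cancel_right₀ _ (by positivity)]
  calc ((j + 1 + t).choose j : ℝ) * (t + 2) ^ t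
      < (j + 1 + t).choose j * (Real.exp 1 * (t + 1) ^ t) := by
        gcongr
        exact add_two_pow_lt_exp_mul t
    _ = ((j + 1 + t).choose j * (t + 1)) * ((t + 1 : ℝ) ^ t / (t + 1) * Real.exp 1) := by
        field_simp
    _ = _ := by
        rw [← hc]
        ring

/-- The weight of the `j`-th term of `forestCount_succ`, relative to `(m + 1) ^ (m - 1)`, is at
least its limit as `m` tends to infinity. -/
lemma pow_le_choose_mul {m j : ℕ} (hj : j ≤ m) :
    (m + 1 : ℝ) ^ m / (m + 1) ≤
      m.choose j * ((m - j + 1 : ℝ) ^ (m - j) / (m - j + 1)) *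
        (j.factorial * Real.exp 1 ^ j) := by
  induction j with
  | zero => simp
  | succ j ih =>
    refine (ih (by lia)).trans ?_
    refine (mul_le_mul_of_nonneg_right (choose_mul_pow_lt hj).le (by positivity)).trans_eq ?_
    rw [Nat.factorial_succ, pow_succ]
    push_cast
    ring

lemma forestCount_zero : forestCount 0 = 1 := by
  have : {F : SimpleGraph (Fin 0) | F.IsAcyclic} = Set.univ :=
    Set.eq_univ_of_forall fun _ ↦ SimpleGraph.IsAcyclic.of_subsingleton
  simp [forestCount, this, Set.ncard_univ]

lemma forestCount_one : forestCount 1 = 1 := by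
  have h := forestCount_succ 0
  norm_num [forestCount_zero] at h
  exact_mod_cast h

lemma forestCount_two : forestCount 2 = 2 := by
  have h := forestCount_succ 1
  norm_num [sum_range_succ, forestCount_zero, forestCount_one] at h
  exact_mod_cast h

lemma forestCount_three : forestCount 3 = 7 := by
  have h := forestCount_succ 2
  norm_num [sum_range_succ, forestCount_zero, forestCount_one, forestCount_two] at h
  exact_mod_cast h

lemma forestCount_four : forestCount 4 = 38 := by
  have h := forestCount_succ 3
  norm_num [sum_range_succ, forestCount_zero, forestCount_one, forestCount_two,
    forestCount_three, Nat.choose] at h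
  exact_mod_cast h

lemma forestCount_five : forestCount 5 = 291 := by
  have h := forestCount_succ 4
  norm_num [sum_range_succ, forestCount_zero, forestCount_one, forestCount_two,
    forestCount_three, forestCount_four, Nat.choose] at h
  exact_mod_cast h

lemma forestCount_six : forestCount 6 = 2932 := by
  have h := forestCount_succ 5
  norm_num [sum_range_succ, forestCount_zero, forestCount_one, forestCount_two,
    forestCount_three, forestCount_four, forestCount_five, Nat.choose] at h
  exact_mod_cast h

lemma sum_forestCount_div_lt_two :
    ∑ j ∈ range 7, (forestCount j : ℝ) / (j.factorial * Real.exp 1 ^ j) < 2 := by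
  have he : (2.7 : ℝ) ≤ Real.exp 1 := by linarith [Real.exp_one_gt_d9]
  calc _ ≤ ∑ j ∈ range 7, (forestCount j : ℝ) / (j.factorial * 2.7 ^ j) := by
        gcongr
    _ < 2 := by
        norm_num [sum_range_succ, forestCount_zero, forestCount_one, forestCount_two,
          forestCount_three, forestCount_four, forestCount_five, forestCount_six, Nat.factorial]

/-- The terms of `forestCount_succ` with `j ≤ 6` suffice once they are all present. -/
lemma pow_mul_sum_lt_forestCount_succ {m : ℕ} (hm : 6 ≤ m) :
    (m + 1 : ℝ) ^ m / (m + 1) *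
        ∑ j ∈ range 7, (forestCount j : ℝ) / (j.factorial * Real.exp 1 ^ j) <
      forestCount (m + 1) := by
  have hnonneg (j : ℕ) (hj : j ∈ range (m + 1)) :
      0 ≤ m.choose j * forestCount j * ((m - j + 1 : ℝ) ^ (m - j) / (m - j + 1)) := by
    have : (j : ℝ) ≤ m := by exact_mod_cast Nat.lt_succ_iff.1 (mem_range.1 hj)
    have : (0 : ℝ) ≤ m - j + 1 := by linarith
    positivity
  rw [forestCount_succ, mul_sum]
  refine lt_of_lt_of_le (sum_lt_sum (fun j hj ↦ ?_) ⟨1, by simp, ?_⟩)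
    (sum_le_sum_of_subset_of_nonneg (range_mono (by lia)) fun j hj _ ↦ hnonneg j hj)
  · have h := pow_le_choose_mul (m := m) (j := j) (by have := mem_range.1 hj; lia)
    rw [← mul_div_assoc, div_le_iff₀ (by positivity)]
    exact (mul_le_mul_of_nonneg_right h (Nat.cast_nonneg (forestCount j))).trans_eq (by ring)
  · have h := choose_mul_pow_lt (m := m) (j := 0) (by lia)
    rw [← mul_div_assoc, div_lt_iff₀ (by positivity)]
    simpa [forestCount_one] using h

theorem forestCount_gt_sum_seven (n : ℕ) (hn : 2 ≤ n) :
    (forestCount n : ℝ)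
      > (n : ℝ) ^ (n - 2)
          * ∑ j ∈ Finset.range 7,
              (forestCount j : ℝ) / ((Nat.factorial j : ℝ) * Real.exp 1 ^ j) := by
  obtain hlt | hle := lt_or_ge n 7
  · refine lt_of_lt_of_le
      (mul_lt_mul_of_pos_left sum_forestCount_div_lt_two (by positivity)) ?_
    interval_cases n <;> norm_num [forestCount_two, forestCount_three, forestCount_four,
      forestCount_five, forestCount_six]
  · obtain ⟨m, rfl⟩ : ∃ m, n = m + 2 := ⟨n - 2, by lia⟩
    have h := pow_mul_sum_lt_forestCount_succ (m := m + 1) (by lia)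
    have hpow : (((m + 1 : ℕ) : ℝ) + 1) ^ (m + 1) / (((m + 1 : ℕ) : ℝ) + 1) =
        ((m + 2 : ℕ) : ℝ) ^ (m + 2 - 2) := by
      rw [pow_succ, mul_div_cancel_right₀ _ (by positivity)]
      push_cast
      congr 1
      ring
    rwa [hpow] at h
end
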